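/- U distributes over Boolean disjunctions of LTL-formulae in lax semantics: let α₁, …, αₙ and β₁, …, βₘ be LTL-formulae (⊽-free TeamLTL-formulae). For every team T: T ⊨ˡ (α₁ ⊽ ⋯ ⊽ αₙ) U (β₁ ⊽ ⋯ ⊽ βₘ) if and only if T ⊨ˡ ⊽_{1≤i≤n, 1≤j≤m} (αᵢ U βⱼ). -/

import Mathlib

namespace TeamLTL

/-- A trace over atomic propositions `AP` is an infinite sequence of sets of propositions. -/
abbrev Trace (AP : Type) := ℕ → Set AP

/-- `t[i,∞]`, the suffix of a trace. -/
def Trace.suffix {AP : Type} (t : Trace AP) (i : ℕ) : Trace AP := fun j => t (i + j)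

/-- A team is a set of traces. -/
abbrev Team (AP : Type) := Set (Trace AP)

/-- `T[f,∞] = { t[s,∞] : t ∈ T, s ∈ f t }` for `f : T → P(ℕ)⁺`. -/
def Team.update {AP : Type} (T : Team AP) (f : Trace AP → Set ℕ) : Team AP :=
  { s | ∃ t ∈ T, ∃ i ∈ f t, s = Trace.suffix t i }

/-- `f` maps every trace of `T` to a nonempty set of naturals (i.e. `f : T → P(ℕ)⁺`). -/
def properOn {AP : Type} (T : Team AP) (f : Trace AP → Set ℕ) : Prop :=
  ∀ t ∈ T, (f t).Nonempty

/-- `f' < f` on the team `T'`: for all `t ∈ T'`, `min (f' t) ≤ min (f t)` and whenever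
`f t` has a maximum, `f' t` has a maximum which is strictly smaller. -/
def funLT {AP : Type} (T' : Team AP) (f' f : Trace AP → Set ℕ) : Prop :=
  ∀ t ∈ T', sInf (f' t) ≤ sInf (f t) ∧
    ∀ m, IsGreatest (f t) m → ∃ m', IsGreatest (f' t) m' ∧ m' < m

/-- Formulae of TeamLTL, together with the Boolean disjunction `bor` (⊽) and the
Boolean negation `bneg` (∼).  Plain TeamLTL-formulae (= LTL-formulae in negation
normal form) are those satisfying `isLTL` below. -/
inductive Formula (AP : Type) : Type
  | atom  : AP → Formula AP
  | natom : AP → Formula AP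
  | conj  : Formula AP → Formula AP → Formula AP
  | disj  : Formula AP → Formula AP → Formula AP
  | next  : Formula AP → Formula AP
  | glob  : Formula AP → Formula AP
  | untl  : Formula AP → Formula AP → Formula AP
  | bor   : Formula AP → Formula AP → Formula AP
  | bneg  : Formula AP → Formula AP

/-- Lax team semantics `T ⊨ˡ φ`. -/
def laxSat {AP : Type} : Formula AP → Team AP → Prop
  | .atom p, T => ∀ t ∈ T, p ∈ t 0
  | .natom p, T => ∀ t ∈ T, p ∉ t 0
  | .conj φ ψ, T => laxSat φ T ∧ laxSat ψ T
  | .disj φ ψ, T => ∃ T₁ T₂ : Team AP, T = T₁ ∪ T₂ ∧ laxSat φ T₁ ∧ laxSat ψ T₂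
  | .next φ, T => laxSat φ (Team.update T (fun _ => {1}))
  | .glob φ, T => ∀ f, properOn T f → laxSat φ (Team.update T f)
  | .untl φ ψ, T => ∃ f, properOn T f ∧ laxSat ψ (Team.update T f) ∧
      ({t ∈ T | f t ≠ ({0} : Set ℕ)} = ∅ ∨
        ∀ f', properOn {t ∈ T | f t ≠ ({0} : Set ℕ)} f' →
          funLT {t ∈ T | f t ≠ ({0} : Set ℕ)} f' f →
          laxSat φ (Team.update {t ∈ T | f t ≠ ({0} : Set ℕ)} f'))
  | .bor φ ψ, T => laxSat φ T ∨ laxSat ψ T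
  | .bneg φ, T => ¬ laxSat φ T

/-- Classical LTL semantics on a single trace. -/
def traceSat {AP : Type} : Formula AP → Trace AP → Prop
  | .atom p, t => p ∈ t 0
  | .natom p, t => p ∉ t 0
  | .conj φ ψ, t => traceSat φ t ∧ traceSat ψ t
  | .disj φ ψ, t => traceSat φ t ∨ traceSat ψ t
  | .next φ, t => traceSat φ (Trace.suffix t 1)
  | .glob φ, t => ∀ i, traceSat φ (Trace.suffix t i)
  | .untl φ ψ, t => ∃ i, traceSat ψ (Trace.suffix t i) ∧ ∀ j < i, traceSat φ (Trace.suffix t j)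
  | .bor φ ψ, t => traceSat φ t ∨ traceSat ψ t
  | .bneg φ, t => ¬ traceSat φ t

/-- `φ` is a plain LTL-formula (no ⊽ and no ∼). -/
def Formula.isLTL {AP : Type} : Formula AP → Prop
  | .atom _ => True
  | .natom _ => True
  | .conj φ ψ => φ.isLTL ∧ ψ.isLTL
  | .disj φ ψ => φ.isLTL ∧ ψ.isLTL
  | .next φ => φ.isLTL
  | .glob φ => φ.isLTL
  | .untl φ ψ => φ.isLTL ∧ ψ.isLTL
  | .bor _ _ => False
  | .bneg _ => False

/-- `φ` is a TeamLTL(⊽)-formula (no Boolean negation ∼). -/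
def Formula.noBneg {AP : Type} : Formula AP → Prop
  | .atom _ => True
  | .natom _ => True
  | .conj φ ψ => φ.noBneg ∧ ψ.noBneg
  | .disj φ ψ => φ.noBneg ∧ ψ.noBneg
  | .next φ => φ.noBneg
  | .glob φ => φ.noBneg
  | .untl φ ψ => φ.noBneg ∧ ψ.noBneg
  | .bor φ ψ => φ.noBneg ∧ ψ.noBneg
  | .bneg _ => False

/-- `φ` is a TeamLTL(∼)-formula (no Boolean disjunction ⊽). -/
def Formula.noBor {AP : Type} : Formula AP → Prop
  | .atom _ => True
  | .natom _ => True
  | .conj φ ψ => φ.noBor ∧ ψ.noBor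
  | .disj φ ψ => φ.noBor ∧ ψ.noBor
  | .next φ => φ.noBor
  | .glob φ => φ.noBor
  | .untl φ ψ => φ.noBor ∧ ψ.noBor
  | .bor _ _ => False
  | .bneg φ => φ.noBor

/-- Left-flatness: in every subformula `G ψ` and `ψ U θ`, `ψ` is an LTL-formula;
moreover `φ` is a TeamLTL(⊽)-formula (no ∼). -/
def Formula.leftFlat {AP : Type} : Formula AP → Prop
  | .atom _ => True
  | .natom _ => True
  | .conj φ ψ => φ.leftFlat ∧ ψ.leftFlat
  | .disj φ ψ => φ.leftFlat ∧ ψ.leftFlat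
  | .next φ => φ.leftFlat
  | .glob φ => φ.isLTL
  | .untl φ ψ => φ.isLTL ∧ ψ.leftFlat
  | .bor φ ψ => φ.leftFlat ∧ ψ.leftFlat
  | .bneg _ => False

/-- Left-downward closure: in every subformula `G ψ` and `ψ U θ`, `ψ` is a
TeamLTL(⊽)-formula (contains no ∼). -/
def Formula.leftDC {AP : Type} : Formula AP → Prop
  | .atom _ => True
  | .natom _ => True
  | .conj φ ψ => φ.leftDC ∧ ψ.leftDC
  | .disj φ ψ => φ.leftDC ∧ ψ.leftDC
  | .next φ => φ.leftDC
  | .glob φ => φ.noBneg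
  | .untl φ ψ => φ.noBneg ∧ ψ.leftDC
  | .bor φ ψ => φ.leftDC ∧ ψ.leftDC
  | .bneg φ => φ.leftDC

/-- Length (size) of a formula. -/
def Formula.size {AP : Type} : Formula AP → ℕ
  | .atom _ => 1
  | .natom _ => 1
  | .conj φ ψ => φ.size + ψ.size + 1
  | .disj φ ψ => φ.size + ψ.size + 1
  | .next φ => φ.size + 1
  | .glob φ => φ.size + 1
  | .untl φ ψ => φ.size + ψ.size + 1
  | .bor φ ψ => φ.size + ψ.size + 1
  | .bneg φ => φ.size + 1

/-- Number of occurrences of the Boolean disjunction ⊽ in a formula. -/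
def Formula.borCount {AP : Type} : Formula AP → ℕ
  | .atom _ => 0
  | .natom _ => 0
  | .conj φ ψ => φ.borCount + ψ.borCount
  | .disj φ ψ => φ.borCount + ψ.borCount
  | .next φ => φ.borCount
  | .glob φ => φ.borCount
  | .untl φ ψ => φ.borCount + ψ.borCount
  | .bor φ ψ => φ.borCount + ψ.borCount + 1
  | .bneg φ => φ.borCount

/-- Boolean disjunction `⊽` of a nonempty list of formulae (head plus tail). -/
def disjOf {AP : Type} : Formula AP → List (Formula AP) → Formula AP
  | a, [] => a
  | a, b :: l => .bor a (disjOf b l)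

/-- Conjunction `a ∧ ⋀ l` of a formula with a (possibly empty) list of formulae. -/
def conjAnd {AP : Type} (a : Formula AP) : List (Formula AP) → Formula AP
  | [] => a
  | b :: l => .conj (conjAnd a l) b

/-- Some atomic proposition occurring in a formula. -/
def Formula.someAtom {AP : Type} : Formula AP → AP
  | .atom p => p
  | .natom p => p
  | .conj φ _ => φ.someAtom
  | .disj φ _ => φ.someAtom
  | .next φ => φ.someAtom
  | .glob φ => φ.someAtom
  | .untl φ _ => φ.someAtom
  | .bor φ _ => φ.someAtom
  | .bneg φ => φ.someAtom

/-- The dual `φ^d`: the negation normal form of `¬φ` (for LTL-formulae `φ`).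
`¬Gφ` is rewritten as `⊤ U ¬φ` and `¬(φUψ)` as `(¬ψ U (¬φ ∧ ¬ψ)) ∨ G¬ψ`. -/
def Formula.dual {AP : Type} : Formula AP → Formula AP
  | .atom p => .natom p
  | .natom p => .atom p
  | .conj φ ψ => .disj φ.dual ψ.dual
  | .disj φ ψ => .conj φ.dual ψ.dual
  | .next φ => .next φ.dual
  | .glob φ => .untl (.disj (.atom φ.someAtom) (.natom φ.someAtom)) φ.dual
  | .untl φ ψ => .disj (.untl ψ.dual (.conj φ.dual ψ.dual)) (.glob ψ.dual)
  | .bor φ ψ => .conj φ.dual ψ.dual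
  | .bneg φ => φ

/-- `∃β`, an abbreviation for `∼β^d`: it holds in a team `T` iff some trace of `T`
satisfies `β` classically. -/
def Formula.exi {AP : Type} (β : Formula AP) : Formula AP := .bneg β.dual

end TeamLTL

namespace TeamLTL

theorem forall_mem_update {AP : Type} {T : Team AP} {f : Trace AP → Set ℕ}
    {P : Trace AP → Prop} :
    (∀ s ∈ Team.update T f, P s) ↔ ∀ t ∈ T, ∀ i ∈ f t, P (Trace.suffix t i) := by
  constructor
  · exact fun h t ht i hi => h _ ⟨t, ht, i, hi, rfl⟩
  · rintro h _ ⟨t, ht, i, hi, rfl⟩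
    exact h t ht i hi

/-- All positions before the minimum of `f t`, together with position `0`. -/
def initialPositions {AP : Type} (f : Trace AP → Set ℕ) : Trace AP → Set ℕ :=
  fun t => {j | j = 0 ∨ j < sInf (f t)}

theorem funLT_initialPositions {AP : Type} {T : Team AP} {f : Trace AP → Set ℕ}
    (hf : properOn T f) :
    funLT {t ∈ T | f t ≠ ({0} : Set ℕ)} (initialPositions f) f := by
  rintro t ⟨ht, hne⟩
  have hzero : (0 : ℕ) ∈ initialPositions f t := Or.inl rfl
  refine ⟨(Nat.sInf_le hzero).trans (Nat.zero_le _), fun m hm => ⟨sInf (f t) - 1, ⟨?_, ?_⟩, ?_⟩⟩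
  · change _ = 0 ∨ _ < _
    omega
  · intro j hj
    change j = 0 ∨ j < _ at hj
    omega
  · have hle : sInf (f t) ≤ m := Nat.sInf_le hm.1
    have hpos : m ≠ 0 := by
      rintro rfl
      exact hne ((Set.Nonempty.subset_singleton_iff (hf t ht)).1
        fun j hj => Nat.le_zero.1 (hm.2 hj))
    omega

/-- Among the functions below `f`, it is enough to use the one given by `initialPositions`. -/
theorem laxSat_untl_initialPositions {AP : Type} {φ ψ : Formula AP} {T : Team AP}
    (h : laxSat (.untl φ ψ) T) :
    ∃ f, properOn T f ∧ laxSat ψ (Team.update T f) ∧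
      ({t ∈ T | f t ≠ ({0} : Set ℕ)} = ∅ ∨
        laxSat φ (Team.update {t ∈ T | f t ≠ ({0} : Set ℕ)} (initialPositions f))) := by
  obtain ⟨f, hf, hψ, hφ⟩ := h
  exact ⟨f, hf, hψ, hφ.imp_right fun h =>
    h _ (fun _ _ => ⟨0, Or.inl rfl⟩) (funLT_initialPositions hf)⟩

theorem forall_traceSat_untl {AP : Type} {φ ψ : Formula AP} {T : Team AP}
    {f : Trace AP → Set ℕ} (hf : properOn T f)
    (hψ : ∀ s ∈ Team.update T f, traceSat ψ s)
    (hφ : {t ∈ T | f t ≠ ({0} : Set ℕ)} = ∅ ∨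
      ∀ s ∈ Team.update {t ∈ T | f t ≠ ({0} : Set ℕ)} (initialPositions f), traceSat φ s) :
    ∀ t ∈ T, traceSat (.untl φ ψ) t := by
  intro t ht
  refine ⟨sInf (f t), forall_mem_update.1 hψ t ht _ (Nat.sInf_mem (hf t ht)), fun j hj => ?_⟩
  have hmem : t ∈ {t ∈ T | f t ≠ ({0} : Set ℕ)} := by
    refine ⟨ht, fun h => ?_⟩
    simp [h] at hj
  rcases hφ with h | h
  · exact absurd hmem (h ▸ Set.notMem_empty t)
  · exact forall_mem_update.1 h t hmem j (Or.inr hj)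

/-- Flatness of LTL-formulae in lax team semantics. -/
theorem laxSat_iff_forall_traceSat {AP : Type} {φ : Formula AP} (hφ : φ.isLTL) (T : Team AP) :
    laxSat φ T ↔ ∀ t ∈ T, traceSat φ t := by
  induction φ generalizing T with
  | atom p => rfl
  | natom p => rfl
  | conj φ ψ ihφ ihψ =>
    simp only [laxSat, traceSat, ihφ hφ.1, ihψ hφ.2]
    exact ⟨fun h t ht => ⟨h.1 t ht, h.2 t ht⟩,
      fun h => ⟨fun t ht => (h t ht).1, fun t ht => (h t ht).2⟩⟩
  | disj φ ψ ihφ ihψ =>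
    simp only [laxSat, traceSat, ihφ hφ.1, ihψ hφ.2]
    constructor
    · rintro ⟨T₁, T₂, rfl, h₁, h₂⟩ t ht
      exact ht.imp (h₁ t) (h₂ t)
    · intro h
      refine ⟨{t ∈ T | traceSat φ t}, {t ∈ T | traceSat ψ t}, ?_, fun t ht => ht.2,
        fun t ht => ht.2⟩
      ext t
      constructor
      · exact fun ht => (h t ht).imp (And.intro ht) (And.intro ht)
      · rintro (ht | ht) <;> exact ht.1
  | next φ ih =>
    simp only [laxSat, traceSat, ih hφ, forall_mem_update, Set.mem_singleton_iff, forall_eq]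
  | glob φ ih =>
    simp only [laxSat, traceSat, ih hφ, forall_mem_update]
    exact ⟨fun h t ht i => h (fun _ => {i}) (fun _ _ => Set.singleton_nonempty i) t ht i rfl,
      fun h f _ t ht i _ => h t ht i⟩
  | untl φ ψ ihφ ihψ =>
    constructor
    · intro h
      obtain ⟨f, hf, h₂, h₁⟩ := laxSat_untl_initialPositions h
      exact forall_traceSat_untl hf ((ihψ hφ.2 _).1 h₂) (h₁.imp_right (ihφ hφ.1 _).1)
    · intro h
      choose! i hψ hi using h
      refine ⟨fun t => {i t}, fun _ _ => Set.singleton_nonempty _, ?_, Or.inr fun f' _ hlt => ?_⟩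
      · rw [ihψ hφ.2, forall_mem_update]
        rintro t ht _ rfl
        exact hψ t ht
      · rw [ihφ hφ.1, forall_mem_update]
        intro t ht j hj
        obtain ⟨m, hm, hmi⟩ := (hlt t ht).2 (i t) isGreatest_singleton
        exact hi t ht.1 j ((hm.2 hj).trans_lt hmi)
  | bor φ ψ => exact hφ.elim
  | bneg φ => exact hφ.elim

theorem laxSat_disjOf {AP : Type} (φ : Formula AP) (l : List (Formula AP)) (T : Team AP) :
    laxSat (disjOf φ l) T ↔ ∃ γ ∈ φ :: l, laxSat γ T := by
  induction l generalizing φ with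
  | nil => simp [disjOf]
  | cons ψ l ih => simp [disjOf, laxSat, ih]

theorem laxSat_untl_mono {AP : Type} {φ φ' ψ ψ' : Formula AP} {T : Team AP}
    (hφ : ∀ S, laxSat φ S → laxSat φ' S) (hψ : ∀ S, laxSat ψ S → laxSat ψ' S)
    (h : laxSat (.untl φ ψ) T) : laxSat (.untl φ' ψ') T := by
  obtain ⟨f, hf, h₂, h₁⟩ := h
  exact ⟨f, hf, hψ _ h₂, h₁.imp_right fun h f' hf' hlt => hφ _ (h f' hf' hlt)⟩

theorem laxSat_untl_disjOf {AP : Type} (α β : Formula AP) (αs βs : List (Formula AP))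
    (hα : ∀ γ ∈ α :: αs, γ.isLTL) (hβ : ∀ γ ∈ β :: βs, γ.isLTL) (T : Team AP) :
    laxSat (.untl (disjOf α αs) (disjOf β βs)) T ↔
      ∃ a ∈ α :: αs, ∃ b ∈ β :: βs, laxSat (.untl a b) T := by
  constructor
  · intro h
    obtain ⟨f, hf, h₂, h₁⟩ := laxSat_untl_initialPositions h
    obtain ⟨b, hb, h₂⟩ := (laxSat_disjOf _ _ _).1 h₂
    have key : ∃ a ∈ α :: αs, {t ∈ T | f t ≠ ({0} : Set ℕ)} = ∅ ∨
        laxSat a (Team.update {t ∈ T | f t ≠ ({0} : Set ℕ)} (initialPositions f)) := by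
      rcases h₁ with h₁ | h₁
      · exact ⟨α, List.mem_cons_self, Or.inl h₁⟩
      · obtain ⟨a, ha, h₁⟩ := (laxSat_disjOf _ _ _).1 h₁
        exact ⟨a, ha, Or.inr h₁⟩
    obtain ⟨a, ha, h₁⟩ := key
    have hLTL : (Formula.untl a b).isLTL := ⟨hα a ha, hβ b hb⟩
    exact ⟨a, ha, b, hb, (laxSat_iff_forall_traceSat hLTL T).2
      (forall_traceSat_untl hf ((laxSat_iff_forall_traceSat hLTL.2 _).1 h₂)
        (h₁.imp_right (laxSat_iff_forall_traceSat hLTL.1 _).1))⟩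
  · rintro ⟨a, ha, b, hb, h⟩
    exact laxSat_untl_mono (fun S hS => (laxSat_disjOf _ _ S).2 ⟨a, ha, hS⟩)
      (fun S hS => (laxSat_disjOf _ _ S).2 ⟨b, hb, hS⟩) h

/-- `U` distributes over Boolean disjunctions of LTL-formulae in lax semantics:
`T ⊨ˡ (α₁ ⊽ ⋯ ⊽ αₙ) U (β₁ ⊽ ⋯ ⊽ βₘ)` iff `T ⊨ˡ ⊽_{i,j} (αᵢ U βⱼ)`. -/
theorem until_distributes_over_bor {AP : Type} (α β : Formula AP)
    (αs βs : List (Formula AP))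
    (hα : ∀ γ ∈ α :: αs, γ.isLTL) (hβ : ∀ γ ∈ β :: βs, γ.isLTL) (T : Team AP) :
    laxSat (Formula.untl (disjOf α αs) (disjOf β βs)) T ↔
      laxSat (disjOf (Formula.untl α β)
        (βs.map (fun b => Formula.untl α b) ++
          αs.flatMap (fun a => (β :: βs).map (fun b => Formula.untl a b)))) T := by
  rw [laxSat_untl_disjOf α β αs βs hα hβ, laxSat_disjOf]
  have hlist : Formula.untl α β :: (βs.map (fun b => Formula.untl α b) ++
      αs.flatMap (fun a => (β :: βs).map (fun b => Formula.untl a b))) =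
      (α :: αs).flatMap (fun a => (β :: βs).map (fun b => Formula.untl a b)) := by
    simp
  rw [hlist]
  simp only [List.mem_flatMap, List.mem_map]
  constructor
  · rintro ⟨a, ha, b, hb, h⟩
    exact ⟨_, ⟨a, ha, b, hb, rfl⟩, h⟩
  · rintro ⟨_, ⟨a, ha, b, hb, rfl⟩, h⟩
    exact ⟨a, ha, b, hb, h⟩

end TeamLTL
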